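/- If a point p = (x, y, z, t) ∈ ℂ⁴ is a critical point of f (i.e. ∂f/∂x, ∂f/∂y, ∂f/∂z and ∂f/∂t all vanish at p) and moreover f(p) = 0, then x·y = 0 and z·t = 0 at p. (The second step in the proof of the claim of Section 4.4: on Σ ∩ {f = 0} one has x·y = 0 = z·t.) -/

import Mathlib

theorem hasDerivAt_cubic (a b c d s : ℂ) :
    HasDerivAt (fun u : ℂ => a * u ^ 3 + b * u ^ 2 + c * u + d) (3 * a * s ^ 2 + 2 * b * s + c) s := by
  have h := ((((hasDerivAt_pow 3 s).const_mul a).add ((hasDerivAt_pow 2 s).const_mul b)).add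
    ((hasDerivAt_id s).const_mul c)).add_const d
  refine h.congr_deriv ?_
  norm_num
  ring

theorem deriv_eq_of_eq_cubic {g : ℂ → ℂ} (a b c d : ℂ)
    (hg : ∀ u, g u = a * u ^ 3 + b * u ^ 2 + c * u + d) (s : ℂ) :
    deriv g s = 3 * a * s ^ 2 + 2 * b * s + c := by
  rw [funext hg]
  exact (hasDerivAt_cubic a b c d s).deriv

theorem statement_15 (lam : ℂ) (hlam : lam ≠ 0)
    (f : ℂ → ℂ → ℂ → ℂ → ℂ)
    (hf : ∀ x y z t : ℂ,
      f x y z t = x * y ^ 2 + x ^ 2 * y + z * t ^ 3 + t * z ^ 3 + lam * x * y * z * t)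
    (x y z t : ℂ)
    (h0 : f x y z t = 0)
    (hx : deriv (fun s => f s y z t) x = 0)
    (hy : deriv (fun s => f x s z t) y = 0)
    (hz : deriv (fun s => f x y s t) z = 0)
    (ht : deriv (fun s => f x y z s) t = 0) :
    x * y = 0 ∧ z * t = 0 := by
  rw [deriv_eq_of_eq_cubic 0 y (y ^ 2 + lam * y * z * t) (z * t ^ 3 + t * z ^ 3)
    (fun u => by rw [hf]; ring)] at hx
  rw [deriv_eq_of_eq_cubic 0 x (x ^ 2 + lam * x * z * t) (z * t ^ 3 + t * z ^ 3)
    (fun u => by rw [hf]; ring)] at hy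
  rw [deriv_eq_of_eq_cubic t 0 (t ^ 3 + lam * x * y * t) (x * y ^ 2 + x ^ 2 * y)
    (fun u => by rw [hf]; ring)] at hz
  rw [deriv_eq_of_eq_cubic z 0 (z ^ 3 + lam * x * y * z) (x * y ^ 2 + x ^ 2 * y)
    (fun u => by rw [hf]; ring)] at ht
  rw [hf] at h0
  -- The Euler identities in `(x, y)` and in `(z, t)` force the mixed term to vanish.
  have hmixed : lam * x * y * z * t = 0 := by
    linear_combination (-6) * h0 + 2 * x * hx + 2 * y * hy + 3 / 2 * z * hz + 3 / 2 * t * ht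
  have hxy : x ^ 2 * y = 0 := by
    linear_combination 2 / 3 * x * hx - 1 / 3 * y * hy - 1 / 3 * hmixed
  have hzt : z ^ 3 * t = 0 := by
    linear_combination 3 / 8 * z * hz - 1 / 8 * t * ht - 1 / 4 * hmixed
  constructor
  · simpa using hxy
  · simpa using hzt
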